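/- If the toric algebra A_E is consistent, then the kernel of π: ℤ^{Q₁} → ℤ(Q) is exactly the subgroup of ℤ^{Q₁} generated by the vectors v(p⁺) − v(p⁻) taken over all generating superpotential relations p⁺ − p⁻ of J_W; consequently π coincides with the quotient map wt: ℤ^{Q₁} → Λ = ℤ^{Q₁}/(v(p⁺) − v(p⁻)), and A_E is graded by the semigroup Λ₊ = wt(ℕ^{Q₁}) = ℕ(Q), with a path p in degree π(v(p)). -/

import Mathlib

namespace NCCell
/-- Toric data for a normal affine toric variety `X = Spec k[σ^∨ ∩ M]` of dimension `n`
with a torus-invariant point: the strongly convex, full-dimensional rational cone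
`σ ⊆ ℝⁿ` is recorded through the primitive generators `v ρ` of its `d` extremal rays. -/
structure ToricData (n d : ℕ) where
  v : Fin d → Fin n → ℤ
  primitive : ∀ ρ, Finset.univ.gcd (fun i => (v ρ i).natAbs) = 1
  strongly_convex : ∃ u : Fin n → ℤ, ∀ ρ, 0 < ∑ i, u i * v ρ i
  full_dim : ∀ u : Fin n → ℤ, (∀ ρ, ∑ i, u i * v ρ i = 0) → u = 0
  extremal_rays : ∀ ρ : Fin d, ∃ u : Fin n → ℤ,
    (∑ i, u i * v ρ i = 0) ∧ ∀ ρ', ρ' ≠ ρ → 0 < ∑ i, u i * v ρ' i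

namespace ToricData
variable {n d : ℕ} (T : ToricData n d)
/-- The inclusion `M = ℤⁿ → ℤᵈ`, `u ↦ (⟨u, v_ρ⟩)_ρ`, from the exact sequence
`0 → M → ℤᵈ → Cl(X) → 0`. -/
def iota : (Fin n → ℤ) →+ (Fin d → ℤ) where
  toFun u := fun ρ => ∑ i, u i * T.v ρ i
  map_zero' := by funext ρ; simp
  map_add' u w := by funext ρ; simp [add_mul, Finset.sum_add_distrib]
/-- The sublattice of `ℤᵈ` of principal torus-invariant Weil divisors, i.e. the image
of `M`; the class group `Cl(X)` is the quotient `ℤᵈ ⧸ prin`. -/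
def prin : AddSubgroup (Fin d → ℤ) := T.iota.range
/-- `X` is Gorenstein: `(1,…,1)` lies in (the image of) `M`. -/
def Gorenstein : Prop := (fun _ => 1 : Fin d → ℤ) ∈ T.prin
end ToricData

def toInt {d : ℕ} (u : Fin d → ℕ) : Fin d → ℤ := fun ρ => (u ρ : ℤ)

/-- A collection of distinct rank one reflexive sheaves on `X`, recorded through Weil
divisor representatives `D i` of their divisor classes. -/
structure Collection {n d : ℕ} (T : ToricData n d) (I : Type*) where
  D : I → Fin d → ℤ
  distinct : ∀ i j : I, D i - D j ∈ T.prin → i = j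

namespace Collection
section
variable {n d : ℕ} {T : ToricData n d} {I : Type*} (C : Collection T I)
/-- `u ∈ ℕᵈ` is (the divisor of zeroes of) a torus-invariant section of
`Hom(E_i, E_j) = H⁰(X, O_X(D_j - D_i))`, i.e. `u` is effective of class `[D_j - D_i]`. -/
def IsSection (i j : I) (u : Fin d → ℕ) : Prop :=
  toInt u - (C.D j - C.D i) ∈ T.prin
/-- A torus-invariant section is irreducible if it admits no nontrivial factorisation
through a member of the collection. -/
def IsIrreducible (i j : I) (u : Fin d → ℕ) : Prop :=
  C.IsSection i j u ∧
    ∀ (l : I) (u₁ u₂ : Fin d → ℕ), u = u₁ + u₂ →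
      C.IsSection i l u₂ → C.IsSection l j u₁ →
      (l = i ∧ u₂ = 0) ∨ (l = j ∧ u₁ = 0)
/-- An arrow of the quiver of sections `Q` of the collection: an irreducible
torus-invariant section, with its head, tail and labelling divisor `div(a) ∈ ℕᵈ`. -/
structure Arrow where
  src : I
  tgt : I
  lab : Fin d → ℕ
  irred : C.IsIrreducible src tgt lab
  nontriv : ¬ (src = tgt ∧ lab = 0)
/-- Paths in the quiver of sections (`nil i` is the trivial path `e_i`, and
`cons p a _` is the path `a·p`, i.e. `a` traversed last). -/
inductive Path : I → I → Type _
  | nil (i : I) : Path i i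
  | cons {i j : I} (p : Path i j) (a : C.Arrow) (h : a.src = j) : Path i a.tgt
end

section
variable {n d : ℕ} {T : ToricData n d} {I : Type*} {C : Collection T I}
/-- The labelling divisor `div(p) ∈ ℕᵈ` of a path. -/
def Path.lab {i : I} : {j : I} → C.Path i j → (Fin d → ℕ)
  | _, .nil _ => 0
  | _, .cons p a _ => Path.lab p + a.lab
/-- Composition of paths: `p.comp q` traverses `p` first, then `q`. -/
def Path.comp {i j : I} (p : C.Path i j) : {l : I} → C.Path j l → C.Path i l
  | _, .nil _ => p
  | _, .cons q a h => .cons (Path.comp p q) a h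
/-- The arrow traversed last by a path. -/
def Path.lastArrow? {i : I} : {j : I} → C.Path i j → Option (C.Arrow)
  | _, .nil _ => none
  | _, .cons _ a _ => some a
/-- The arrow traversed first by a path. -/
def Path.firstArrow? {i : I} : {j : I} → C.Path i j → Option (C.Arrow)
  | _, .nil _ => none
  | _, .cons p a _ => some ((Path.firstArrow? p).getD a)
/-- The list of arrows traversed by a path (last traversed first). -/
def Path.arrows {i : I} : {j : I} → C.Path i j → List (C.Arrow)
  | _, .nil _ => []
  | _, .cons p a _ => a :: Path.arrows p

/-- `pp - pm` is one of the generating relations of the ideal of superpotential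
relations `J_W`: there is a path `q` such that the derivative `∂_q W` of the
superpotential `W = Σ_{p anticanonical cycle} p` is the sum of precisely the two paths
`pp` and `pm`, and these two paths share neither initial nor final arrow.  (Here
`∂_q W` is the sum of all paths `p` with tail at `h(q)`, head at `t(q)` and labelling
monomial `x^{div p} = Π_ρ x_ρ / x^{div q}`.) -/
def IsSPRel {i j : I} (pp pm : C.Path i j) : Prop :=
  ∃ q : C.Path j i,
    (∀ ρ, pp.lab ρ + q.lab ρ = 1) ∧ (∀ ρ, pm.lab ρ + q.lab ρ = 1) ∧
    pp ≠ pm ∧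
    pp.firstArrow? ≠ pm.firstArrow? ∧ pp.lastArrow? ≠ pm.lastArrow? ∧
    (∀ p : C.Path i j, (∀ ρ, p.lab ρ + q.lab ρ = 1) → p = pp ∨ p = pm)

/-- F-term equivalence of paths: the equivalence relation generated by
`q₂ p₊ q₁ ∼ q₂ p₋ q₁` for superpotential relations `p₊ - p₋ ∈ J_W`.  Two paths are
identified in the superpotential algebra `A_W = kQ/J_W` iff they are F-term equivalent. -/
inductive FTermEquiv : {i j : I} → C.Path i j → C.Path i j → Prop
  | rel {i j l m : I} {pp pm : C.Path i j} (q₁ : C.Path l i) (q₂ : C.Path j m)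
      (h : IsSPRel pp pm) :
      FTermEquiv ((q₁.comp pp).comp q₂) ((q₁.comp pm).comp q₂)
  | refl {i j : I} (p : C.Path i j) : FTermEquiv p p
  | symm {i j : I} {p q : C.Path i j} : FTermEquiv p q → FTermEquiv q p
  | trans {i j : I} {p q r : C.Path i j} : FTermEquiv p q → FTermEquiv q r → FTermEquiv p r
end

/-- The toric algebra `A_𝓔 = kQ/J_𝓔` is consistent, i.e. `J_𝓔 = J_W`: since (classes of)
paths form bases of both quotient algebras, this says precisely that two paths of `Q`
with the same head and tail are identified in `A_𝓔` (i.e. share the same labelling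
divisor) if and only if they are identified in `A_W` (i.e. are F-term equivalent). -/
def Consistent {n d : ℕ} {T : ToricData n d} {I : Type*} (C : Collection T I) : Prop :=
  ∀ (i j : I) (p q : C.Path i j), p.lab = q.lab ↔ FTermEquiv p q

end Collection
end NCCell

namespace NCCell
namespace Collection
section
variable {n d : ℕ} {T : ToricData n d} {I : Type*} [DecidableEq I] (C : Collection T I)

/-- The value `π(χ_a) = (χ_{h(a)} - χ_{t(a)}, div a)` of the map
`π = (inc, div) : ℤ^{Q₁} → Wt(Q) ⊕ ℤᵈ` on the characteristic function of an arrow. -/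
def piGen (a : C.Arrow) : (I → ℤ) × (Fin d → ℤ) :=
  (fun i => (if i = a.tgt then 1 else 0) - (if i = a.src then 1 else 0), toInt a.lab)

/-- The lattice `ℤ(Q) = π(ℤ^{Q₁})`, realised as the subgroup of `ℤ^{Q₀} ⊕ ℤᵈ`
generated by the vectors `π(χ_a)`. -/
def latZQ : AddSubgroup ((I → ℤ) × (Fin d → ℤ)) :=
  AddSubgroup.closure (Set.range C.piGen)

/-- The semigroup `ℕ(Q) = π(ℕ^{Q₁})`, realised as the subsemigroup of `ℤ^{Q₀} ⊕ ℤᵈ`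
generated by the vectors `π(χ_a)`. -/
def semiNQ : AddSubmonoid ((I → ℤ) × (Fin d → ℤ)) :=
  AddSubmonoid.closure (Set.range C.piGen)

end
end Collection
end NCCell

namespace NCCell
namespace Collection
section
variable {n d : ℕ} {T : ToricData n d} {I : Type*} {C : Collection T I}

/-- The vector `v(p) ∈ ℤ^{Q₁}` recording how many times a path traverses each arrow. -/
noncomputable def Path.vec {i : I} : {j : I} → C.Path i j → (C.Arrow →₀ ℤ)
  | _, .nil _ => 0
  | _, .cons p a _ => Path.vec p + Finsupp.single a 1
end

section
variable {n d : ℕ} {T : ToricData n d} {I : Type*} [DecidableEq I] (C : Collection T I)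

/-- The map `π = (inc, div) : ℤ^{Q₁} → Wt(Q) ⊕ ℤᵈ` sending `χ_a` to
`(χ_{h(a)} - χ_{t(a)}, div a)`. -/
noncomputable def piHom : (C.Arrow →₀ ℤ) →+ ((I → ℤ) × (Fin d → ℤ)) :=
  Finsupp.liftAddHom fun a => zmultiplesHom _ (C.piGen a)

end
end Collection
end NCCell

namespace NCCell
namespace Collection

section Paths
variable {n d : ℕ} {T : ToricData n d} {I : Type*} {C : Collection T I}

lemma Path.vec_comp {i j l : I} (p : C.Path i j) (q : C.Path j l) :
    (p.comp q).vec = p.vec + q.vec := by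
  induction q with
  | nil => simp [Path.comp, Path.vec]
  | cons q a h ih => simp [Path.comp, Path.vec, ih, add_assoc]

/-- The path consisting of a single arrow. -/
def Arrow.toPath (a : C.Arrow) : C.Path a.src a.tgt := .cons (.nil a.src) a rfl

lemma Arrow.vec_toPath (a : C.Arrow) : a.toPath.vec = Finsupp.single a 1 := by
  simp [Arrow.toPath, Path.vec]

lemma toInt_injective : Function.Injective (toInt : (Fin d → ℕ) → Fin d → ℤ) :=
  fun u w h => funext fun ρ => by simpa [toInt] using congrFun h ρ

lemma toInt_add (u w : Fin d → ℕ) : toInt (u + w) = toInt u + toInt w := by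
  ext ρ; simp [toInt]

lemma toInt_zero : toInt (0 : Fin d → ℕ) = 0 := by
  ext ρ; simp [toInt]

lemma IsSection.eq_of_zero {i j : I} (h : C.IsSection i j 0) : i = j :=
  C.distinct i j (by simpa [IsSection, toInt_zero] using h)

/-- Every torus-invariant section factors into arrows, so it is carried by a path. -/
lemma IsSection.nonempty_path {i j : I} {u : Fin d → ℕ} (h : C.IsSection i j u) :
    Nonempty (C.Path i j) := by
  induction hN : ∑ ρ, u ρ using Nat.strong_induction_on generalizing i j u with
  | _ N ih =>
    by_cases hirr : C.IsIrreducible i j u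
    · by_cases htriv : i = j ∧ u = 0
      · obtain ⟨rfl, -⟩ := htriv
        exact ⟨.nil i⟩
      · exact ⟨Arrow.toPath ⟨i, j, u, hirr, htriv⟩⟩
    · have hfac : ∃ (l : I) (u₁ u₂ : Fin d → ℕ), u = u₁ + u₂ ∧ C.IsSection i l u₂ ∧
          C.IsSection l j u₁ ∧ ¬ (l = i ∧ u₂ = 0) ∧ ¬ (l = j ∧ u₁ = 0) := by
        by_contra hcontra
        refine hirr ⟨h, fun l u₁ u₂ hu h₂ h₁ => ?_⟩
        by_contra hne
        exact hcontra ⟨l, u₁, u₂, hu, h₂, h₁, not_or.mp hne⟩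
      obtain ⟨l, u₁, u₂, rfl, h₂, h₁, hne₂, hne₁⟩ := hfac
      have pos : ∀ w : Fin d → ℕ, w ≠ 0 → 0 < ∑ ρ, w ρ := fun w hw => by
        refine Nat.pos_of_ne_zero fun hsum => hw (funext fun ρ => ?_)
        exact Finset.sum_eq_zero_iff.mp hsum ρ (Finset.mem_univ ρ)
      have pos₂ := pos u₂ fun h0 => hne₂ ⟨(h0 ▸ h₂).eq_of_zero.symm, h0⟩
      have pos₁ := pos u₁ fun h0 => hne₁ ⟨(h0 ▸ h₁).eq_of_zero, h0⟩
      have hsum : ∑ ρ, u₁ ρ + ∑ ρ, u₂ ρ = N := by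
        rw [← hN, ← Finset.sum_add_distrib]; rfl
      obtain ⟨p⟩ := ih _ (by omega) h₂ rfl
      obtain ⟨q⟩ := ih _ (by omega) h₁ rfl
      exact ⟨p.comp q⟩

variable (C) in
/-- Every divisor class contains an effective divisor, because `σ` is strongly convex. -/
lemma exists_isSection (i j : I) : ∃ u : Fin d → ℕ, C.IsSection i j u := by
  obtain ⟨m, hm⟩ := T.strongly_convex
  set E : Fin d → ℤ := C.D j - C.D i
  set N : ℤ := ∑ ρ, |E ρ|
  have hE : ∀ ρ, 0 ≤ E ρ + T.iota (N • m) ρ := fun ρ => by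
    have h₁ : |E ρ| ≤ N :=
      Finset.single_le_sum (f := fun ρ => |E ρ|) (fun _ _ => abs_nonneg _) (Finset.mem_univ ρ)
    have h₂ : 1 ≤ T.iota m ρ := hm ρ
    have h₃ : T.iota (N • m) ρ = N * T.iota m ρ := by rw [map_zsmul]; rfl
    have h₄ : 0 ≤ N := (abs_nonneg _).trans h₁
    have h₅ := neg_abs_le (E ρ)
    rw [h₃]
    nlinarith
  refine ⟨fun ρ => (E ρ + T.iota (N • m) ρ).toNat, N • m, ?_⟩
  ext ρ
  simp only [toInt, Pi.sub_apply, Int.toNat_of_nonneg (hE ρ)]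
  change _ = E ρ + T.iota (N • m) ρ - E ρ
  ring

variable (C) in
/-- The quiver of sections is strongly connected. -/
lemma nonempty_path (i j : I) : Nonempty (C.Path i j) :=
  (C.exists_isSection i j).elim fun _ h => h.nonempty_path

variable (C) in
/-- The subgroup of `ℤ^{Q₁}` generated by the vectors `v(p⁺) - v(p⁻)` of the superpotential
relations. -/
noncomputable def relLattice : AddSubgroup (C.Arrow →₀ ℤ) :=
  AddSubgroup.closure {x | ∃ (i j : I) (pp pm : C.Path i j), IsSPRel pp pm ∧
    x = pp.vec - pm.vec}

lemma FTermEquiv.vec_sub_mem {i j : I} {p q : C.Path i j} (h : FTermEquiv p q) :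
    p.vec - q.vec ∈ C.relLattice := by
  induction h with
  | @rel i j l m pp pm q₁ q₂ h =>
    simp only [Path.vec_comp, add_sub_add_right_eq_sub, add_sub_add_left_eq_sub]
    exact AddSubgroup.subset_closure ⟨i, j, pp, pm, h, rfl⟩
  | refl p => simp
  | symm _ ih => simpa using neg_mem ih
  | trans _ _ ih₁ ih₂ => simpa using add_mem ih₁ ih₂

variable (C) in
/-- The subgroup of `ℤ^{Q₁}` of differences of vectors of cycles based at `o`. -/
noncomputable def cycleDifferences (o : I) : AddSubgroup (C.Arrow →₀ ℤ) where
  carrier := {x | ∃ p q : C.Path o o, x = p.vec - q.vec}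
  zero_mem' := ⟨.nil o, .nil o, by simp⟩
  add_mem' := by
    rintro _ _ ⟨p, q, rfl⟩ ⟨p', q', rfl⟩
    exact ⟨p.comp p', q.comp q', by simp only [Path.vec_comp]; abel⟩
  neg_mem' := by
    rintro _ ⟨p, q, rfl⟩
    exact ⟨q, p, by simp⟩

end Paths

section Degree
variable {n d : ℕ} {T : ToricData n d} {I : Type*} [DecidableEq I] {C : Collection T I}

lemma piHom_single (a : C.Arrow) (z : ℤ) : C.piHom (Finsupp.single a z) = z • C.piGen a := by
  simp [piHom]

lemma piHom_vec {i j : I} (p : C.Path i j) :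
    C.piHom p.vec = (Pi.single j 1 - Pi.single i 1, toInt p.lab) := by
  induction p with
  | nil => simp [Path.vec, Path.lab, toInt_zero, Prod.ext_iff]
  | cons p a h ih =>
    subst h
    rw [Path.vec, map_add, ih, piHom_single, one_smul, Path.lab, toInt_add, piGen]
    ext l
    · simp [Pi.single_apply]
    · simp

lemma piHom_vec_mem_semiNQ {i j : I} (p : C.Path i j) : C.piHom p.vec ∈ C.semiNQ := by
  induction p with
  | nil => simp [Path.vec]
  | cons p a h ih =>
    rw [Path.vec, map_add, piHom_single, one_smul]
    exact add_mem ih (AddSubmonoid.subset_closure ⟨a, rfl⟩)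

lemma relLattice_le_ker_piHom : C.relLattice ≤ C.piHom.ker := by
  refine (AddSubgroup.closure_le _).mpr ?_
  rintro _ ⟨i, j, pp, pm, ⟨q, hp, hm, -⟩, rfl⟩
  have hlab : pp.lab = pm.lab := funext fun ρ => by have := hp ρ; have := hm ρ; omega
  simp [AddMonoidHom.mem_ker, piHom_vec, hlab]

lemma sub_sum_mem_cycleDifferences [Fintype I] (o : I) (s : ∀ i, C.Path o i)
    (x : C.Arrow →₀ ℤ) :
    x - ∑ i, (C.piHom x).1 i • (s i).vec ∈ C.cycleDifferences o := by
  induction x using Finsupp.induction_linear with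
  | zero => simp
  | add x y hx hy =>
    convert add_mem hx hy using 1
    simp only [map_add, Prod.fst_add, Pi.add_apply, add_smul, Finset.sum_add_distrib]
    abel
  | single a z =>
    have key : Finsupp.single a 1 - ((s a.tgt).vec - (s a.src).vec) ∈
        C.cycleDifferences o := by
      obtain ⟨t⟩ := C.nonempty_path a.tgt o
      refine ⟨((s a.src).comp a.toPath).comp t, (s a.tgt).comp t, ?_⟩
      simp only [Path.vec_comp, Arrow.vec_toPath]
      abel
    convert zsmul_mem key z using 1
    rw [piHom_single, smul_sub, Finsupp.smul_single, smul_eq_mul, mul_one]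
    simp [piGen, mul_sub, sub_smul, smul_sub, Finset.sum_sub_distrib]

lemma Consistent.ker_piHom_le_relLattice [Fintype I] [Nonempty I] (hcon : C.Consistent) :
    C.piHom.ker ≤ C.relLattice := by
  intro x hx
  rw [AddMonoidHom.mem_ker] at hx
  obtain ⟨o⟩ := ‹Nonempty I›
  obtain ⟨p, q, hpq⟩ :=
    sub_sum_mem_cycleDifferences o (fun i => (C.nonempty_path o i).some) x
  have hxpq : x = p.vec - q.vec := by simpa [hx] using hpq
  subst hxpq
  have hlab : p.lab = q.lab := toInt_injective <| by
    simpa [piHom_vec, sub_eq_zero] using congrArg Prod.snd hx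
  exact ((hcon o o p q).mp hlab).vec_sub_mem

end Degree

end Collection
end NCCell

open NCCell Collection

/-- Lemma 3.8: if the toric algebra `A_𝓔` is consistent then the
kernel of `π : ℤ^{Q₁} → ℤ(Q)` is exactly the subgroup generated by the vectors
`v(p⁺) - v(p⁻)` over the generating superpotential relations `p⁺ - p⁻` of `J_W`;
consequently `π` coincides with the quotient map `wt : ℤ^{Q₁} → Λ`, and `A_𝓔` is graded
by the semigroup `Λ₊ = wt(ℕ^{Q₁}) = ℕ(Q)`, a path `p` being homogeneous of degree
`π(v(p)) ∈ ℕ(Q)`. -/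
theorem consistent_ker_pi_eq_superpotential_relations
    {n d : ℕ} (T : ToricData n d) (hGor : T.Gorenstein) {r : ℕ}
    (C : Collection T (Fin (r + 1))) (hD₀ : C.D 0 = 0)
    (hcon : C.Consistent) :
    -- `ker π` is generated by the vectors of the superpotential relations, i.e.
    -- `π = wt` and `Λ = ℤ(Q)`:
    (C.piHom.ker = AddSubgroup.closure
      {x : C.Arrow →₀ ℤ | ∃ (i j : Fin (r + 1)) (pp pm : C.Path i j),
        IsSPRel pp pm ∧ x = pp.vec - pm.vec})
    -- the degree of a path lies in `Λ₊ = ℕ(Q)` …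
    ∧ (∀ (i j : Fin (r + 1)) (p : C.Path i j), C.piHom p.vec ∈ C.semiNQ)
    -- … and descends to `A_𝓔 = A_W`, giving the `Λ₊`-grading of `A_𝓔`:
    ∧ (∀ (i j : Fin (r + 1)) (p q : C.Path i j),
        FTermEquiv p q → C.piHom p.vec = C.piHom q.vec) := by
  refine ⟨le_antisymm hcon.ker_piHom_le_relLattice relLattice_le_ker_piHom,
    fun i j p => piHom_vec_mem_semiNQ p, fun i j p q h => ?_⟩
  rw [piHom_vec, piHom_vec, (hcon i j p q).mpr h]
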